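/- arXiv:2007.05857 — 2 statements merged into one kernel-verified Lean document; each statement's English description precedes it below -/
import Mathlib

section
/- (Approximate decision reliability) Let f : {-1,1}^n → {-1,1}, let P_π be the product measure on {-1,1}^n with probabilities p_1,…,p_n ∈ (0,1), fix ρ ∈ (−1,1), and let Y be the noisy copy of X in which independently each coordinate satisfies Y_i = X_i with probability ½(1+ρ) and Y_i = −X_i with probability ½(1−ρ). Suppose f is unbiased in the sense that E_π[f(X)] = 0 and E_{π,ρ}[f(Y)] = 0. Then the decision reliability cor_{π,ρ}(f(X), f(Y)) satisfies | cor_{π,ρ}(f(X), f(Y)) − ρ Σ_{i=1}^n ω(i) f̂^π({i}) f̂^{π,ρ}({i}) | ≤ ρ², where ω(i) = σ_i/σ_i^ρ. -/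
/-- Encode a Boolean coordinate as an element of {-1, 1} ⊆ ℝ. -/
noncomputable def toR (b : Bool) : ℝ := if b then 1 else -1

/-- Weight of a point `x ∈ {-1,1}ⁿ` under the product measure with `P(Xᵢ = 1) = pᵢ`. -/
noncomputable def wPi (n : ℕ) (p : Fin n → ℝ) (x : Fin n → Bool) : ℝ :=
  ∏ i, (if x i then p i else 1 - p i)

/-- Expectation under the product measure `P_π` on `{-1,1}ⁿ`. -/
noncomputable def piE (n : ℕ) (p : Fin n → ℝ) (f : (Fin n → Bool) → ℝ) : ℝ :=
  ∑ x : Fin n → Bool, wPi n p x * f x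

/-- The mean `μᵢ = 2pᵢ - 1` of coordinate `i`. -/
noncomputable def mu (n : ℕ) (p : Fin n → ℝ) (i : Fin n) : ℝ := 2 * p i - 1

/-- The standard deviation `σᵢ = √(1 - μᵢ²)` of coordinate `i`. -/
noncomputable def sigma (n : ℕ) (p : Fin n → ℝ) (i : Fin n) : ℝ :=
  Real.sqrt (1 - mu n p i ^ 2)

/-- The standardised coordinate `φ(xᵢ) = (xᵢ - μᵢ)/σᵢ`. -/
noncomputable def phi (n : ℕ) (p : Fin n → ℝ) (i : Fin n) (x : Fin n → Bool) : ℝ :=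
  (toR (x i) - mu n p i) / sigma n p i

/-- The p-biased basis function `φ_S(x) = ∏_{i∈S} φ(xᵢ)` (with `φ_∅ = 1`). -/
noncomputable def phiS (n : ℕ) (p : Fin n → ℝ) (S : Finset (Fin n)) (x : Fin n → Bool) : ℝ :=
  ∏ i ∈ S, phi n p i x

/-- The p-biased Fourier coefficient `f̂^π(S) = E_π[f(X) φ_S(X)]`. -/
noncomputable def fourierPi (n : ℕ) (p : Fin n → ℝ) (f : (Fin n → Bool) → ℝ)
    (S : Finset (Fin n)) : ℝ :=
  piE n p (fun x => f x * phiS n p S x)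

/-- Weight of the noisy copy `y` given `x`: independently each coordinate satisfies
`yᵢ = xᵢ` with probability `(1+ρ)/2` and `yᵢ = -xᵢ` with probability `(1-ρ)/2`. -/
noncomputable def wNoise (n : ℕ) (ρ : ℝ) (x y : Fin n → Bool) : ℝ :=
  ∏ i, (if y i = x i then (1 + ρ) / 2 else (1 - ρ) / 2)

/-- Joint expectation `E_{π,ρ}`: first over the noise given `X`, then over `X ~ P_π`. -/
noncomputable def jointE (n : ℕ) (p : Fin n → ℝ) (ρ : ℝ)
    (g : (Fin n → Bool) → (Fin n → Bool) → ℝ) : ℝ :=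
  ∑ x : Fin n → Bool, ∑ y : Fin n → Bool, wPi n p x * wNoise n ρ x y * g x y

/-- The standard deviation `σᵢ^ρ = √(1 - ρ²μᵢ²)` of the noisy coordinate `Yᵢ`. -/
noncomputable def sigmaRho (n : ℕ) (p : Fin n → ℝ) (ρ : ℝ) (i : Fin n) : ℝ :=
  Real.sqrt (1 - ρ ^ 2 * mu n p i ^ 2)

/-- The standardised noisy coordinate `φ^ρ(yᵢ) = (yᵢ - ρμᵢ)/σᵢ^ρ`. -/
noncomputable def phiRho (n : ℕ) (p : Fin n → ℝ) (ρ : ℝ) (i : Fin n) (y : Fin n → Bool) : ℝ :=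
  (toR (y i) - ρ * mu n p i) / sigmaRho n p ρ i

/-- The basis function `φ^ρ_S(y) = ∏_{i∈S} φ^ρ(yᵢ)` (with `φ^ρ_∅ = 1`). -/
noncomputable def phiRhoS (n : ℕ) (p : Fin n → ℝ) (ρ : ℝ) (S : Finset (Fin n))
    (y : Fin n → Bool) : ℝ :=
  ∏ i ∈ S, phiRho n p ρ i y

/-- The Fourier coefficient `f̂^{π,ρ}(S) = E_{π,ρ}[f(Y) φ^ρ_S(Y)]`. -/
noncomputable def fourierRho (n : ℕ) (p : Fin n → ℝ) (ρ : ℝ) (f : (Fin n → Bool) → ℝ)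
    (S : Finset (Fin n)) : ℝ :=
  jointE n p ρ (fun _ y => f y * phiRhoS n p ρ S y)

/-- The probability `P(Yᵢ = 1) = (1 + ρμᵢ)/2` of the noisy coordinate `Yᵢ`. -/
noncomputable def noisyProb (n : ℕ) (p : Fin n → ℝ) (ρ : ℝ) (i : Fin n) : ℝ :=
  (1 + ρ * mu n p i) / 2

theorem mu_noisyProb (n : ℕ) (p : Fin n → ℝ) (ρ : ℝ) (i : Fin n) :
    mu n (noisyProb n p ρ) i = ρ * mu n p i := by
  unfold noisyProb
  rw [mu]
  ring

theorem sigma_noisyProb (n : ℕ) (p : Fin n → ℝ) (ρ : ℝ) (i : Fin n) :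
    sigma n (noisyProb n p ρ) i = sigmaRho n p ρ i := by
  rw [sigma, sigmaRho, mu_noisyProb, mul_pow]

theorem phiRhoS_eq_phiS (n : ℕ) (p : Fin n → ℝ) (ρ : ℝ) :
    phiRhoS n p ρ = phiS n (noisyProb n p ρ) := by
  funext S y
  simp only [phiRhoS, phiS, phiRho, phi, mu_noisyProb, sigma_noisyProb]

theorem abs_mu_lt_one {n : ℕ} {p : Fin n → ℝ} (hp : ∀ i, p i ∈ Set.Ioo (0 : ℝ) 1) (i : Fin n) :
    |mu n p i| < 1 := by
  have := hp i
  rw [mu, abs_lt]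
  constructor <;> linarith [this.1, this.2]

theorem noisyProb_mem_Ioo {n : ℕ} {p : Fin n → ℝ} (hp : ∀ i, p i ∈ Set.Ioo (0 : ℝ) 1)
    {ρ : ℝ} (hρ : |ρ| < 1) (i : Fin n) : noisyProb n p ρ i ∈ Set.Ioo (0 : ℝ) 1 := by
  have h : |ρ * mu n p i| < 1 := by
    rw [abs_mul]
    exact mul_lt_one_of_nonneg_of_lt_one_left (abs_nonneg _) hρ (abs_mu_lt_one hp i).le
  rw [abs_lt] at h
  unfold noisyProb
  constructor <;> linarith [h.1, h.2]

theorem sigma_pos {n : ℕ} {p : Fin n → ℝ} (hp : ∀ i, p i ∈ Set.Ioo (0 : ℝ) 1) (i : Fin n) :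
    0 < sigma n p i := by
  have h := (sq_lt_one_iff_abs_lt_one _).2 (abs_mu_lt_one hp i)
  exact Real.sqrt_pos.2 (by linarith)

theorem sigma_sq {n : ℕ} {p : Fin n → ℝ} (hp : ∀ i, p i ∈ Set.Ioo (0 : ℝ) 1) (i : Fin n) :
    sigma n p i ^ 2 = 1 - mu n p i ^ 2 :=
  Real.sq_sqrt (Real.sqrt_pos.1 (sigma_pos hp i)).le

/-- A sum over the cube of a product of functions of one coordinate factorises. -/
theorem sum_prod_coord {n : ℕ} (g : Fin n → Bool → ℝ) :
    ∑ x : Fin n → Bool, ∏ i, g i (x i) = ∏ i, (g i true + g i false) := by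
  have h := Finset.prod_univ_sum (fun _ : Fin n => (Finset.univ : Finset Bool)) g
  simp only [Fintype.piFinset_univ, Fintype.sum_bool] at h
  exact h.symm

/-- Completeness of the `p`-biased basis. -/
theorem wPi_mul_sum_phiS {n : ℕ} {p : Fin n → ℝ} (hp : ∀ i, p i ∈ Set.Ioo (0 : ℝ) 1)
    (x y : Fin n → Bool) :
    wPi n p y * ∑ S : Finset (Fin n), phiS n p S x * phiS n p S y = if x = y then 1 else 0 := by
  have h (i : Fin n) : (if y i then p i else 1 - p i) * (1 + phi n p i x * phi n p i y) =
      if x i = y i then 1 else 0 := by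
    have hs := (sigma_pos hp i).ne'
    have hsq := sigma_sq hp i
    have h1 : phi n p i x * phi n p i y =
        (toR (x i) - mu n p i) * (toR (y i) - mu n p i) / (1 - mu n p i ^ 2) := by
      rw [phi, phi, div_mul_div_comm, ← sq, hsq]
    have h2 : 1 - mu n p i ^ 2 ≠ 0 := by rw [← hsq]; positivity
    rw [h1, one_add_div h2, mul_div_assoc', div_eq_iff h2]
    unfold mu toR
    cases x i <;> cases y i <;> simp only [reduceIte, Bool.false_eq_true, reduceCtorEq] <;> ring
  simp only [phiS, ← Finset.prod_mul_distrib]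
  rw [← Finset.powerset_univ, ← Finset.prod_one_add, wPi, ← Finset.prod_mul_distrib,
    Finset.prod_congr rfl fun i _ => h i, Finset.prod_ite_zero]
  simp [funext_iff]

theorem parseval {n : ℕ} {p : Fin n → ℝ} (hp : ∀ i, p i ∈ Set.Ioo (0 : ℝ) 1)
    (f : (Fin n → Bool) → ℝ) :
    ∑ S : Finset (Fin n), fourierPi n p f S ^ 2 = piE n p fun x => f x ^ 2 := by
  calc ∑ S : Finset (Fin n), fourierPi n p f S ^ 2
      = ∑ x, ∑ y, wPi n p x * f x * f y *
          (wPi n p y * ∑ S : Finset (Fin n), phiS n p S x * phiS n p S y) := by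
        simp only [fourierPi, piE, sq, Finset.sum_mul_sum]
        simp only [Finset.mul_sum]
        rw [Finset.sum_comm]
        refine Finset.sum_congr rfl fun x _ => ?_
        rw [Finset.sum_comm]
        refine Finset.sum_congr rfl fun y _ => Finset.sum_congr rfl fun S _ => ?_
        ring
    _ = piE n p fun x => f x ^ 2 := by
        simp only [wPi_mul_sum_phiS hp, piE]
        simp [sq, mul_assoc]

theorem sum_wPi (n : ℕ) (p : Fin n → ℝ) : ∑ x, wPi n p x = 1 := by
  simp only [wPi]
  rw [sum_prod_coord fun i b => if b then p i else 1 - p i]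
  simp

theorem sum_wNoise (n : ℕ) (ρ : ℝ) (x : Fin n → Bool) : ∑ y, wNoise n ρ x y = 1 := by
  simp only [wNoise]
  rw [sum_prod_coord fun i b => if b = x i then (1 + ρ) / 2 else (1 - ρ) / 2]
  refine Finset.prod_eq_one fun i _ => ?_
  cases x i <;> simp <;> ring

theorem sum_wPi_mul_wNoise (n : ℕ) (p : Fin n → ℝ) (ρ : ℝ) (y : Fin n → Bool) :
    ∑ x, wPi n p x * wNoise n ρ x y = wPi n (noisyProb n p ρ) y := by
  simp only [wPi, wNoise, ← Finset.prod_mul_distrib]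
  rw [sum_prod_coord fun i b => (if b then p i else 1 - p i) *
    (if y i = b then (1 + ρ) / 2 else (1 - ρ) / 2)]
  refine Finset.prod_congr rfl fun i _ => ?_
  unfold noisyProb mu
  cases y i <;> simp <;> ring

theorem jointE_fst (n : ℕ) (p : Fin n → ℝ) (ρ : ℝ) (g : (Fin n → Bool) → ℝ) :
    jointE n p ρ (fun x _ => g x) = piE n p g := by
  refine Finset.sum_congr rfl fun x _ => ?_
  rw [← Finset.sum_mul, ← Finset.mul_sum, sum_wNoise, mul_one]

theorem jointE_snd (n : ℕ) (p : Fin n → ℝ) (ρ : ℝ) (g : (Fin n → Bool) → ℝ) :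
    jointE n p ρ (fun _ y => g y) = piE n (noisyProb n p ρ) g := by
  rw [jointE, Finset.sum_comm]
  refine Finset.sum_congr rfl fun y _ => ?_
  rw [← Finset.sum_mul, sum_wPi_mul_wNoise]

theorem fourierRho_eq_fourierPi (n : ℕ) (p : Fin n → ℝ) (ρ : ℝ) (f : (Fin n → Bool) → ℝ) :
    fourierRho n p ρ f = fourierPi n (noisyProb n p ρ) f := by
  funext S
  rw [fourierRho, jointE_snd n p ρ fun y => f y * phiRhoS n p ρ S y, phiRhoS_eq_phiS, fourierPi]

/-- The joint law of `(X, Y)` is diagonal in the two biased bases. -/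
theorem wNoise_eq_sum {n : ℕ} {p : Fin n → ℝ} (hp : ∀ i, p i ∈ Set.Ioo (0 : ℝ) 1)
    {ρ : ℝ} (hρ : |ρ| < 1) (x y : Fin n → Bool) :
    wNoise n ρ x y = wPi n (noisyProb n p ρ) y * ∑ S : Finset (Fin n),
      (∏ i ∈ S, ρ * (sigma n p i / sigmaRho n p ρ i)) *
        (phiS n p S x * phiS n (noisyProb n p ρ) S y) := by
  have hq := noisyProb_mem_Ioo hp hρ
  simp only [phiS, ← Finset.prod_mul_distrib]
  rw [← Finset.powerset_univ, ← Finset.prod_one_add, wPi, wNoise, ← Finset.prod_mul_distrib]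
  refine Finset.prod_congr rfl fun i _ => ?_
  have hs := (sigma_pos hp i).ne'
  have ht := (sigma_pos hq i).ne'
  have hsq := sigma_sq hq i
  have h2 : 1 - (ρ * mu n p i) ^ 2 ≠ 0 := by rw [← mu_noisyProb, ← hsq]; positivity
  have h1 : ρ * (sigma n p i / sigmaRho n p ρ i) * (phi n p i x * phi n (noisyProb n p ρ) i y) =
      ρ * (toR (x i) - mu n p i) * (toR (y i) - ρ * mu n p i) / (1 - (ρ * mu n p i) ^ 2) := by
    rw [← mu_noisyProb, ← hsq, phi, phi, ← sigma_noisyProb]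
    field_simp
  rw [h1, one_add_div h2, mul_div_assoc', eq_div_iff h2]
  unfold noisyProb toR
  cases x i <;> cases y i <;> simp only [reduceIte, Bool.false_eq_true, reduceCtorEq] <;> ring

theorem jointE_mul_eq_sum {n : ℕ} {p : Fin n → ℝ} (hp : ∀ i, p i ∈ Set.Ioo (0 : ℝ) 1)
    {ρ : ℝ} (hρ : |ρ| < 1) (f g : (Fin n → Bool) → ℝ) :
    jointE n p ρ (fun x y => f x * g y) = ∑ S : Finset (Fin n),
      (∏ i ∈ S, ρ * (sigma n p i / sigmaRho n p ρ i)) *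
        (fourierPi n p f S * fourierRho n p ρ g S) := by
  simp only [jointE, fourierRho_eq_fourierPi, wNoise_eq_sum hp hρ, fourierPi, piE,
    Finset.sum_mul_sum]
  simp only [Finset.mul_sum, Finset.sum_mul]
  symm
  rw [Finset.sum_comm]
  refine Finset.sum_congr rfl fun x _ => ?_
  rw [Finset.sum_comm]
  refine Finset.sum_congr rfl fun y _ => Finset.sum_congr rfl fun S _ => ?_
  ring

theorem sigma_div_sigmaRho_le_one {n : ℕ} {p : Fin n → ℝ} (hp : ∀ i, p i ∈ Set.Ioo (0 : ℝ) 1)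
    {ρ : ℝ} (hρ : |ρ| < 1) (i : Fin n) : sigma n p i / sigmaRho n p ρ i ≤ 1 := by
  rw [← sigma_noisyProb, div_le_one (sigma_pos (noisyProb_mem_Ioo hp hρ) i), sigma_noisyProb]
  refine Real.sqrt_le_sqrt ?_
  have h := (sq_lt_one_iff_abs_lt_one _).2 hρ
  nlinarith [sq_nonneg (mu n p i)]

theorem abs_prod_noise_le {n : ℕ} {p : Fin n → ℝ} (hp : ∀ i, p i ∈ Set.Ioo (0 : ℝ) 1)
    {ρ : ℝ} (hρ : |ρ| < 1) {S : Finset (Fin n)} (hS : 2 ≤ S.card) :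
    |∏ i ∈ S, ρ * (sigma n p i / sigmaRho n p ρ i)| ≤ ρ ^ 2 := by
  rw [Finset.abs_prod]
  calc ∏ i ∈ S, |ρ * (sigma n p i / sigmaRho n p ρ i)|
      ≤ ∏ _i ∈ S, |ρ| := by
        refine Finset.prod_le_prod (fun i _ => abs_nonneg _) fun i _ => ?_
        have h0 : 0 ≤ sigma n p i / sigmaRho n p ρ i :=
          div_nonneg (Real.sqrt_nonneg _) (Real.sqrt_nonneg _)
        rw [abs_mul, abs_of_nonneg h0]
        exact mul_le_of_le_one_right (abs_nonneg _) (sigma_div_sigmaRho_le_one hp hρ i)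
    _ = |ρ| ^ S.card := Finset.prod_const _
    _ ≤ |ρ| ^ 2 := pow_le_pow_of_le_one (abs_nonneg _) hρ.le hS
    _ = ρ ^ 2 := sq_abs ρ

theorem sum_singleton_eq_sum_ite {n : ℕ} (F : Finset (Fin n) → ℝ) :
    ∑ i, F {i} = ∑ S : Finset (Fin n), if S.card = 1 then F S else 0 := by
  rw [← Finset.sum_filter, ← Finset.powerset_univ, ← Finset.powersetCard_eq_filter,
    Finset.powersetCard_one, Finset.sum_map]
  rfl

/-- Approximate decision reliability: if `f` is unbiased (`E_π[f(X)] = 0` and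
`E_{π,ρ}[f(Y)] = 0`), then the decision reliability (the correlation between `f(X)` and
`f(Y)`) is within `ρ²` of its first-order approximation
`ρ Σᵢ ω(i) f̂^π({i}) f̂^{π,ρ}({i})`, where `ω(i) = σᵢ/σᵢ^ρ`. -/
theorem approx_decision_reliability (n : ℕ) (p : Fin n → ℝ)
    (hp : ∀ i, p i ∈ Set.Ioo (0 : ℝ) 1)
    (ρ : ℝ) (hρ : ρ ∈ Set.Ioo (-1 : ℝ) 1)
    (f : (Fin n → Bool) → ℝ) (hf : ∀ x, f x = 1 ∨ f x = -1)
    (hunbiasedX : piE n p f = 0) (hunbiasedY : jointE n p ρ (fun _ y => f y) = 0) :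
    |(jointE n p ρ (fun x y => f x * f y) -
          jointE n p ρ (fun x _ => f x) * jointE n p ρ (fun _ y => f y)) /
        (Real.sqrt (jointE n p ρ (fun x _ => (f x - jointE n p ρ (fun x _ => f x)) ^ 2)) *
          Real.sqrt (jointE n p ρ (fun _ y => (f y - jointE n p ρ (fun _ y => f y)) ^ 2))) -
      ρ * ∑ i, (sigma n p i / sigmaRho n p ρ i) *
        fourierPi n p f {i} * fourierRho n p ρ f {i}| ≤ ρ ^ 2 := by
  have hρ' : |ρ| < 1 := abs_lt.2 hρ
  have hq := noisyProb_mem_Ioo hp hρ'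
  have hsq : (fun x => f x ^ 2) = fun _ => (1 : ℝ) := by
    funext x
    rcases hf x with h | h <;> simp [h]
  have hone (r : Fin n → ℝ) : piE n r (fun _ => 1) = 1 := by
    simp [piE, sum_wPi]
  have hX : jointE n p ρ (fun x _ => f x) = 0 := by rw [jointE_fst, hunbiasedX]
  simp only [hX, hunbiasedY, sub_zero, mul_zero]
  rw [jointE_fst n p ρ fun x => f x ^ 2, jointE_snd n p ρ fun y => f y ^ 2, hsq, hone, hone,
    Real.sqrt_one, mul_one, div_one, jointE_mul_eq_sum hp hρ']
  set c : Finset (Fin n) → ℝ := fun S => ∏ i ∈ S, ρ * (sigma n p i / sigmaRho n p ρ i) with hc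
  have hlin : ρ * ∑ i, (sigma n p i / sigmaRho n p ρ i) *
      fourierPi n p f {i} * fourierRho n p ρ f {i} = ∑ S : Finset (Fin n),
        if S.card = 1 then c S * (fourierPi n p f S * fourierRho n p ρ f S) else 0 := by
    rw [← sum_singleton_eq_sum_ite, Finset.mul_sum]
    refine Finset.sum_congr rfl fun i _ => ?_
    simp only [hc, Finset.prod_singleton]
    ring
  have hempty : fourierPi n p f ∅ = 0 := by simpa [fourierPi, phiS] using hunbiasedX
  have hA := parseval hp f
  have hB := parseval hq f
  rw [hsq, hone] at hA hB
  rw [← fourierRho_eq_fourierPi] at hB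
  rw [hlin, ← Finset.sum_sub_distrib]
  calc |∑ S : Finset (Fin n), (c S * (fourierPi n p f S * fourierRho n p ρ f S) -
          if S.card = 1 then c S * (fourierPi n p f S * fourierRho n p ρ f S) else 0)|
      ≤ ∑ S : Finset (Fin n),
          ρ ^ 2 * ((fourierPi n p f S ^ 2 + fourierRho n p ρ f S ^ 2) / 2) := by
        refine (Finset.abs_sum_le_sum_abs _ _).trans (Finset.sum_le_sum fun S _ => ?_)
        have hnn : 0 ≤ ρ ^ 2 * ((fourierPi n p f S ^ 2 + fourierRho n p ρ f S ^ 2) / 2) := by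
          positivity
        rcases S.eq_empty_or_nonempty with rfl | hne
        · simpa [hempty] using hnn
        by_cases h1 : S.card = 1
        · simpa [h1] using hnn
        have h2 : 2 ≤ S.card := by have := hne.card_pos; omega
        rw [if_neg h1, sub_zero, abs_mul]
        refine mul_le_mul (abs_prod_noise_le hp hρ' h2) ?_ (abs_nonneg _) (sq_nonneg ρ)
        rw [abs_le]
        constructor
        · nlinarith [sq_nonneg (fourierPi n p f S + fourierRho n p ρ f S)]
        · nlinarith [sq_nonneg (fourierPi n p f S - fourierRho n p ρ f S)]
    _ = ρ ^ 2 := by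
        rw [← Finset.mul_sum, ← Finset.sum_div, Finset.sum_add_distrib, hA, hB]
        norm_num
end

section
/- (Rousseau's criterion) Let P_π be the product measure on {-1,1}^n with probabilities p_1,…,p_n ∈ (0,1), and suppose Σ_{i=1}^n φ(x_i) ≠ 0 for every x ∈ {-1,1}^n, so that ℓ_φ(x) = sgn(Σ_{i=1}^n φ(x_i)) defines a function {-1,1}^n → {-1,1}. Then for every monotone f : {-1,1}^n → {-1,1}, the unscaled total influence satisfies Σ_{i=1}^n σ_i I_i^π(f) = E_π[f(X) Σ_{i=1}^n φ(X_i)] ≤ E_π|Σ_{i=1}^n φ(X_i)| = Σ_{i=1}^n σ_i I_i^π(ℓ_φ); that is, ℓ_φ maximises Σ_i σ_i I_i^π over all monotone Boolean functions. -/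
/-- The discrete derivative `Dᵢf(x) = ½(f(x^{(i,1)}) - f(x^{(i,-1)}))`. -/
noncomputable def Dder (n : ℕ) (f : (Fin n → Bool) → ℝ) (i : Fin n) (x : Fin n → Bool) : ℝ :=
  (f (Function.update x i true) - f (Function.update x i false)) / 2

/-- sign function: 1 if positive, -1 otherwise. -/
noncomputable def sgn (t : ℝ) : ℝ := if 0 < t then 1 else -1

/-- The weight of `x` with coordinate `i` set to `b` splits off the factor of coordinate `i`. -/
theorem wPi_update (n : ℕ) (p : Fin n → ℝ) (i : Fin n) (x : Fin n → Bool) (b : Bool) :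
    wPi n p (Function.update x i b) = (if b then p i else 1 - p i) *
      ∏ j ∈ Finset.univ.erase i, (if x j then p j else 1 - p j) := by
  unfold wPi
  rw [← Finset.mul_prod_erase _ _ (Finset.mem_univ i), Function.update_self]
  congr 1
  refine Finset.prod_congr rfl fun j hj => ?_
  rw [Function.update_of_ne (Finset.ne_of_mem_erase hj)]

/-- Flipping coordinate `i` does not change a sum over the cube. -/
theorem sum_flip (n : ℕ) (i : Fin n) (g : (Fin n → Bool) → ℝ) :
    ∑ x, g (Function.update x i (!x i)) = ∑ x, g x := by
  have h : Function.Involutive (fun x : Fin n → Bool => Function.update x i (!x i)) := by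
    intro x
    simp
  exact Equiv.sum_comp h.toPerm g

/-- Conditioning on all coordinates other than `i`. -/
theorem piE_average (n : ℕ) (p : Fin n → ℝ) (i : Fin n) (g : (Fin n → Bool) → ℝ) :
    piE n p g = piE n p (fun x => p i * g (Function.update x i true) +
      (1 - p i) * g (Function.update x i false)) := by
  have hdouble : ∀ G : (Fin n → Bool) → ℝ, 2 * ∑ x, G x =
      ∑ x, (G (Function.update x i true) + G (Function.update x i false)) := by
    intro G
    rw [two_mul]
    nth_rewrite 2 [← sum_flip n i G]
    rw [← Finset.sum_add_distrib]
    refine Finset.sum_congr rfl fun x _ => ?_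
    have hx := Function.update_eq_self i x
    cases hb : x i <;> rw [hb] at hx <;> simp [hx, add_comm]
  unfold piE
  refine mul_left_cancel₀ (two_ne_zero (α := ℝ)) ?_
  rw [hdouble, hdouble]
  refine Finset.sum_congr rfl fun x _ => ?_
  simp only [wPi_update, Function.update_idem, if_true, Bool.false_eq_true, if_false]
  ring

/-- For a monotone Boolean function, the scaled influence is a degree-one Fourier coefficient. -/
theorem sigma_mul_influence (n : ℕ) (p : Fin n → ℝ) (i : Fin n) (hp : p i ∈ Set.Ioo (0 : ℝ) 1)
    (f : (Fin n → Bool) → ℝ) (hf : ∀ x, f x = 1 ∨ f x = -1)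
    (hmono : ∀ x, f (Function.update x i false) ≤ f (Function.update x i true)) :
    sigma n p i * piE n p (fun x => Dder n f i x ^ 2) = piE n p (fun x => f x * phi n p i x) := by
  have hpos : 0 < 1 - mu n p i ^ 2 := by
    unfold mu
    nlinarith [mul_pos hp.1 (sub_pos.2 hp.2)]
  have hs : sigma n p i ≠ 0 := (Real.sqrt_pos.2 hpos).ne'
  have hsq : sigma n p i ^ 2 = 4 * p i * (1 - p i) := by
    rw [sigma, Real.sq_sqrt hpos.le, mu]
    ring
  rw [piE_average n p i (fun x => f x * phi n p i x)]
  unfold piE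
  rw [Finset.mul_sum]
  refine Finset.sum_congr rfl fun x _ => ?_
  have hD : Dder n f i x ^ 2 = Dder n f i x := by
    have hm := hmono x
    unfold Dder
    rcases hf (Function.update x i true) with h1 | h1 <;>
      rcases hf (Function.update x i false) with h0 | h0 <;>
      rw [h1, h0] at hm ⊢ <;> first | (exfalso; linarith) | norm_num
  beta_reduce
  rw [hD, mul_left_comm]
  congr 1
  simp only [Dder, phi, mu, toR, Function.update_self, if_true, Bool.false_eq_true, if_false]
  field_simp
  rw [hsq]
  ring

/-- The unscaled total influence of a monotone Boolean function is its correlation with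
`Σᵢ φ(xᵢ)`. -/
theorem sum_sigma_mul_influence (n : ℕ) (p : Fin n → ℝ) (hp : ∀ i, p i ∈ Set.Ioo (0 : ℝ) 1)
    (f : (Fin n → Bool) → ℝ) (hf : ∀ x, f x = 1 ∨ f x = -1)
    (hmono : ∀ x y : Fin n → Bool, (∀ i, toR (x i) ≤ toR (y i)) → f x ≤ f y) :
    ∑ i, sigma n p i * piE n p (fun x => Dder n f i x ^ 2) =
      piE n p (fun x => f x * ∑ i, phi n p i x) := by
  have h : ∀ i, sigma n p i * piE n p (fun x => Dder n f i x ^ 2) =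
      piE n p (fun x => f x * phi n p i x) := by
    refine fun i => sigma_mul_influence n p i (hp i) f hf fun x => hmono _ _ fun j => ?_
    by_cases hj : j = i
    · subst hj
      simp only [Function.update_self, toR, if_true, Bool.false_eq_true, if_false]
      norm_num
    · rw [Function.update_of_ne hj, Function.update_of_ne hj]
  rw [Finset.sum_congr rfl fun i _ => h i]
  simp only [piE, Finset.mul_sum]
  exact Finset.sum_comm

theorem sgn_eq_one_or (t : ℝ) : sgn t = 1 ∨ sgn t = -1 := by
  unfold sgn
  split_ifs <;> simp

theorem sgn_mono {s t : ℝ} (h : s ≤ t) : sgn s ≤ sgn t := by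
  unfold sgn
  split_ifs <;> linarith

theorem sgn_mul_self_eq_abs (t : ℝ) : sgn t * t = |t| := by
  unfold sgn
  split_ifs with h
  · rw [abs_of_pos h, one_mul]
  · rw [abs_of_nonpos (not_lt.1 h), neg_one_mul]

/-- Rousseau's criterion: assuming `Σᵢ φ(xᵢ) ≠ 0` everywhere so that
`ℓ_φ(x) = sgn(Σᵢ φ(xᵢ))` is a well-defined Boolean function, for every monotone
`f : {-1,1}ⁿ → {-1,1}` the unscaled total influence satisfies
`Σᵢ σᵢ I_i^π(f) = E_π[f(X) Σᵢ φ(Xᵢ)] ≤ E_π|Σᵢ φ(Xᵢ)| = Σᵢ σᵢ I_i^π(ℓ_φ)`;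
that is, `ℓ_φ` maximises `Σᵢ σᵢ I_i^π` over all monotone Boolean functions. -/
theorem rousseau_criterion (n : ℕ) (p : Fin n → ℝ) (hp : ∀ i, p i ∈ Set.Ioo (0 : ℝ) 1)
    (hne : ∀ x : Fin n → Bool, (∑ i, phi n p i x) ≠ 0)
    (lphi : (Fin n → Bool) → ℝ) (hlphi : ∀ x, lphi x = sgn (∑ i, phi n p i x))
    (f : (Fin n → Bool) → ℝ) (hf : ∀ x, f x = 1 ∨ f x = -1)
    (hmono : ∀ x y : Fin n → Bool, (∀ i, toR (x i) ≤ toR (y i)) → f x ≤ f y) :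
    (∑ i, sigma n p i * piE n p (fun x => Dder n f i x ^ 2) =
      piE n p (fun x => f x * ∑ i, phi n p i x)) ∧
    (piE n p (fun x => f x * ∑ i, phi n p i x) ≤
      piE n p (fun x => |∑ i, phi n p i x|)) ∧
    (piE n p (fun x => |∑ i, phi n p i x|) =
      ∑ i, sigma n p i * piE n p (fun x => Dder n lphi i x ^ 2)) := by
  refine ⟨sum_sigma_mul_influence n p hp f hf hmono, ?_, ?_⟩
  · refine Finset.sum_le_sum fun x _ => mul_le_mul_of_nonneg_left ?_ ?_
    · beta_reduce
      rcases hf x with h | h <;> rw [h]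
      · rw [one_mul]
        exact le_abs_self _
      · rw [neg_one_mul]
        exact neg_le_abs _
    · refine Finset.prod_nonneg fun i _ => ?_
      have := hp i
      split_ifs
      · exact this.1.le
      · exact sub_nonneg.2 this.2.le
  · rw [sum_sigma_mul_influence n p hp lphi]
    · simp only [hlphi, sgn_mul_self_eq_abs]
    · intro x
      rw [hlphi]
      exact sgn_eq_one_or _
    · intro x y hxy
      rw [hlphi, hlphi]
      refine sgn_mono (Finset.sum_le_sum fun i _ => ?_)
      exact div_le_div_of_nonneg_right (sub_le_sub_right (hxy i) _) (Real.sqrt_nonneg _)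
end
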